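/- Let G be a commutative monoid, p, b ∈ G, and let (A g)_{g ∈ G} be a dimensioned Poisson algebra of dimensions (p, b): a family of additive commutative groups equipped with (i) biadditive multiplication maps * : A g → A h → A (p*g*h) that are associative and commutative up to canonical transport along index equalities in G, and (ii) biadditive bracket maps {,} : A g → A h → A (b*g*h) that are antisymmetric and satisfy the Jacobi identity up to canonical transport, such that the Leibniz identity {a, b*c} = {a,b}*c + b*{a,c} holds up to canonical transport. Let I be a dimensioned coisotrope: a family of additive subgroups I g ≤ A g with a * i ∈ I (p*g*h) for all a ∈ A g, i ∈ I h, and {i, j} ∈ I (b*g*h) for all i ∈ I g, j ∈ I h. Define the dimensioned Lie idealizer N(I) by N(I) g := {n ∈ A g | ∀ h, ∀ i ∈ I h, {n, i} ∈ I (b*g*h)}. Then I g ⊆ N(I) g for each g, the families N(I) g are closed under both * and {,}, and the family of quotient groups g ↦ N(I) g ⧸ I g carries a well-defined multiplication *' of dimension p and bracket {,}' of dimension b, uniquely determined by (n + I g) *' (m + I h) = n*m + I (p*g*h) and {n + I g, m + I h}' = {n,m} + I (b*g*h), which make it a dimensioned Poisson algebra of dimensions (p, b). -/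

import Mathlib

universe u v

/-- Canonical transport of elements of a type family along an equality of indices. -/
def dcast {G : Type u} (A : G → Type v) {g h : G} (e : g = h) : A g → A h :=
  fun a => cast (congrArg A e) a

section Dims
variable {G : Type u} [CommMonoid G]

theorem dim_massoc (p g h k : G) : p * (p * g * h) * k = p * g * (p * h * k) := by ac_rfl
theorem dim_mcomm (p g h : G) : p * g * h = p * h * g := by ac_rfl
theorem dim_jac (b g h k : G) : b * h * (b * g * k) = b * g * (b * h * k) := by ac_rfl
theorem dim_leib₁ (p b g h k : G) : p * (b * g * h) * k = b * g * (p * h * k) := by ac_rfl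
theorem dim_leib₂ (p b g h k : G) : p * h * (b * g * k) = b * g * (p * h * k) := by ac_rfl

end Dims

/-- A dimensioned Poisson algebra of dimensions `(p, b)` over a commutative monoid `G`:
a family of additive commutative groups `A g` equipped with biadditive commutative
associative multiplication maps `* : A g → A h → A (p * g * h)` and biadditive
antisymmetric Jacobi bracket maps `{,} : A g → A h → A (b * g * h)` interacting via the
Leibniz identity, index equalities being handled by canonical transport. -/
structure DimPoissonOn {G : Type u} [CommMonoid G] (p b : G) (A : G → Type v)
    [∀ g, AddCommGroup (A g)] where
  mul : ∀ {g h : G}, A g → A h → A (p * g * h)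
  bracket : ∀ {g h : G}, A g → A h → A (b * g * h)
  mul_add : ∀ {g h : G} (x : A g) (y z : A h), mul x (y + z) = mul x y + mul x z
  add_mul : ∀ {g h : G} (x y : A g) (z : A h), mul (x + y) z = mul x z + mul y z
  bracket_add : ∀ {g h : G} (x : A g) (y z : A h),
    bracket x (y + z) = bracket x y + bracket x z
  add_bracket : ∀ {g h : G} (x y : A g) (z : A h),
    bracket (x + y) z = bracket x z + bracket y z
  mul_assoc' : ∀ {g h k : G} (x : A g) (y : A h) (z : A k),
    dcast A (dim_massoc p g h k) (mul (mul x y) z) = mul x (mul y z)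
  mul_comm' : ∀ {g h : G} (x : A g) (y : A h),
    dcast A (dim_mcomm p g h) (mul x y) = mul y x
  bracket_antisymm : ∀ {g h : G} (x : A g) (y : A h),
    dcast A (dim_mcomm b g h) (bracket x y) = - bracket y x
  jacobi : ∀ {g h k : G} (x : A g) (y : A h) (z : A k),
    bracket x (bracket y z)
      = dcast A (dim_massoc b g h k) (bracket (bracket x y) z)
        + dcast A (dim_jac b g h k) (bracket y (bracket x z))
  leibniz : ∀ {g h k : G} (x : A g) (y : A h) (z : A k),
    bracket x (mul y z)
      = dcast A (dim_leib₁ p b g h k) (mul (bracket x y) z)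
        + dcast A (dim_leib₂ p b g h k) (mul y (bracket x z))

section Subquotient

variable {X Y Z : Type*} [AddCommGroup X] [AddCommGroup Y] [AddCommGroup Z]

/-- The map induced by a biadditive map on subquotients. -/
def AddMonoidHom.subquotientMap₂ (f : X →+ Y →+ Z) {N I : AddSubgroup X} {M J : AddSubgroup Y}
    {L K : AddSubgroup Z} (hf : ∀ x ∈ N, ∀ y ∈ M, f x y ∈ L)
    (hleft : ∀ x ∈ I, ∀ y ∈ M, f x y ∈ K) (hright : ∀ x ∈ N, ∀ y ∈ J, f x y ∈ K) :
    ↥N ⧸ I.addSubgroupOf N → ↥M ⧸ J.addSubgroupOf M → ↥L ⧸ K.addSubgroupOf L :=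
  Quotient.map₂ (fun x y => ⟨f x y, hf x x.2 y y.2⟩) <| by
    intro x x' hx y y' hy
    replace hx : -(x : X) + x' ∈ I :=
      QuotientAddGroup.leftRel_apply (s := I.addSubgroupOf N).1 hx
    replace hy : -(y : Y) + y' ∈ J :=
      QuotientAddGroup.leftRel_apply (s := J.addSubgroupOf M).1 hy
    refine QuotientAddGroup.leftRel_apply.2 (?_ : -f x y + f x' y' ∈ K)
    have h := add_mem (hleft _ hx y' y'.2) (hright x x.2 _ hy)
    simp only [map_add, map_neg, AddMonoidHom.add_apply, AddMonoidHom.neg_apply] at h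
    convert h using 1
    abel

end Subquotient

section Transport

variable {G : Type u} {A : G → Type v} [∀ g, AddCommGroup (A g)]

theorem dcast_mem_iff {S : ∀ g, AddSubgroup (A g)} {g h : G} (e : g = h) {x : A g} :
    dcast A e x ∈ S h ↔ x ∈ S g := by
  subst e
  rfl

theorem dcast_subquotient_mk {N I : ∀ g, AddSubgroup (A g)} {g h : G} (e : g = h) (x : ↥(N g)) :
    dcast (fun g => ↥(N g) ⧸ (I g).addSubgroupOf (N g)) e (QuotientAddGroup.mk x)
      = QuotientAddGroup.mk ⟨dcast A e x, (dcast_mem_iff e).2 x.2⟩ := by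
  subst e
  rfl

end Transport

namespace DimPoissonOn

variable {G : Type u} [CommMonoid G] {p b : G} {A : G → Type v} [∀ g, AddCommGroup (A g)]
  (P : DimPoissonOn p b A) {I : ∀ g, AddSubgroup (A g)}

/-- The multiplication as a biadditive map. -/
def mulHom (g h : G) : A g →+ A h →+ A (p * g * h) :=
  AddMonoidHom.mk' (fun x => AddMonoidHom.mk' (P.mul x) (P.mul_add x))
    fun x y => AddMonoidHom.ext (P.add_mul x y)

/-- The bracket as a biadditive map. -/
def bracketHom (g h : G) : A g →+ A h →+ A (b * g * h) :=
  AddMonoidHom.mk' (fun x => AddMonoidHom.mk' (P.bracket x) (P.bracket_add x))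
    fun x y => AddMonoidHom.ext (P.add_bracket x y)

theorem mul_mem_comm {g h : G} {x : A g} {y : A h} :
    P.mul x y ∈ I (p * g * h) ↔ P.mul y x ∈ I (p * h * g) := by
  rw [← P.mul_comm' x y, dcast_mem_iff]

theorem bracket_mem_comm {g h : G} {x : A g} {y : A h} :
    P.bracket x y ∈ I (b * g * h) ↔ P.bracket y x ∈ I (b * h * g) := by
  rw [← neg_mem_iff (x := P.bracket y x), ← P.bracket_antisymm x y, dcast_mem_iff]

variable (I) in
/-- The dimensioned Lie idealizer of a family of subgroups. -/
def idealizer (g : G) : AddSubgroup (A g) where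
  carrier := {n | ∀ (h : G), ∀ i ∈ I h, P.bracket n i ∈ I (b * g * h)}
  add_mem' hx hy h i hi := by
    rw [P.add_bracket]
    exact add_mem (hx h i hi) (hy h i hi)
  zero_mem' h i _ := by
    change P.bracketHom g h 0 i ∈ _
    simp
  neg_mem' {x} hx h i hi := by
    change P.bracketHom g h (-x) i ∈ _
    rw [map_neg, AddMonoidHom.neg_apply]
    exact neg_mem (hx h i hi)

theorem mul_mem_idealizer
    (hImul : ∀ {g h : G} (x : A g) (i : A h), i ∈ I h → P.mul x i ∈ I (p * g * h))
    {g h : G} {n : A g} {m : A h} (hn : n ∈ P.idealizer I g) (hm : m ∈ P.idealizer I h) :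
    P.mul n m ∈ P.idealizer I (p * g * h) := by
  intro k i hi
  rw [P.bracket_mem_comm, P.leibniz]
  refine add_mem ((dcast_mem_iff _).2 ?_) ((dcast_mem_iff _).2 ?_)
  · exact P.mul_mem_comm.2 (hImul _ _ (P.bracket_mem_comm.2 (hn k i hi)))
  · exact hImul _ _ (P.bracket_mem_comm.2 (hm k i hi))

theorem bracket_mem_idealizer
    {g h : G} {n : A g} {m : A h} (hn : n ∈ P.idealizer I g) (hm : m ∈ P.idealizer I h) :
    P.bracket n m ∈ P.idealizer I (b * g * h) := by
  intro k i hi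
  rw [← dcast_mem_iff (dim_massoc b g h k), eq_sub_of_add_eq (P.jacobi n m i).symm]
  exact sub_mem (hn _ _ (hm k i hi)) ((dcast_mem_iff _).2 (hm _ _ (hn k i hi)))

/-- The reduced Poisson algebra on the quotient of the idealizer of a coisotrope. -/
def reduction
    (hImul : ∀ {g h : G} (x : A g) (i : A h), i ∈ I h → P.mul x i ∈ I (p * g * h)) :
    DimPoissonOn p b (fun g => ↥(P.idealizer I g) ⧸ (I g).addSubgroupOf (P.idealizer I g)) where
  mul {g h} := (P.mulHom g h).subquotientMap₂
    (fun _ hx _ hy => P.mul_mem_idealizer hImul hx hy)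
    (fun _ hx _ _ => P.mul_mem_comm.2 (hImul _ _ hx))
    (fun _ _ _ hy => hImul _ _ hy)
  bracket {g h} := (P.bracketHom g h).subquotientMap₂
    (fun _ hx _ hy => P.bracket_mem_idealizer hx hy)
    (fun _ hx _ hy => P.bracket_mem_comm.2 (hy _ _ hx))
    (fun _ hx _ hy => hx _ _ hy)
  mul_add := by
    rintro g h ⟨x⟩ ⟨y⟩ ⟨z⟩
    exact congrArg QuotientAddGroup.mk (Subtype.ext (P.mul_add _ _ _))
  add_mul := by
    rintro g h ⟨x⟩ ⟨y⟩ ⟨z⟩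
    exact congrArg QuotientAddGroup.mk (Subtype.ext (P.add_mul _ _ _))
  bracket_add := by
    rintro g h ⟨x⟩ ⟨y⟩ ⟨z⟩
    exact congrArg QuotientAddGroup.mk (Subtype.ext (P.bracket_add _ _ _))
  add_bracket := by
    rintro g h ⟨x⟩ ⟨y⟩ ⟨z⟩
    exact congrArg QuotientAddGroup.mk (Subtype.ext (P.add_bracket _ _ _))
  mul_assoc' := by
    rintro g h k ⟨x⟩ ⟨y⟩ ⟨z⟩
    exact (dcast_subquotient_mk _ _).trans
      (congrArg QuotientAddGroup.mk (Subtype.ext (P.mul_assoc' _ _ _)))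
  mul_comm' := by
    rintro g h ⟨x⟩ ⟨y⟩
    exact (dcast_subquotient_mk _ _).trans
      (congrArg QuotientAddGroup.mk (Subtype.ext (P.mul_comm' _ _)))
  bracket_antisymm := by
    rintro g h ⟨x⟩ ⟨y⟩
    exact (dcast_subquotient_mk _ _).trans
      (congrArg QuotientAddGroup.mk (Subtype.ext (P.bracket_antisymm _ _)))
  jacobi := by
    rintro g h k ⟨x⟩ ⟨y⟩ ⟨z⟩
    refine Eq.trans ?_
      (congr (congrArg HAdd.hAdd (dcast_subquotient_mk _ _)) (dcast_subquotient_mk _ _)).symm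
    exact congrArg QuotientAddGroup.mk (Subtype.ext (P.jacobi _ _ _))
  leibniz := by
    rintro g h k ⟨x⟩ ⟨y⟩ ⟨z⟩
    refine Eq.trans ?_
      (congr (congrArg HAdd.hAdd (dcast_subquotient_mk _ _)) (dcast_subquotient_mk _ _)).symm
    exact congrArg QuotientAddGroup.mk (Subtype.ext (P.leibniz _ _ _))

end DimPoissonOn



/-- **Dimensioned Poisson Reduction.** Let `A` be a dimensioned Poisson
algebra of dimensions `(p, b)` over a commutative monoid `G` and let `I` be a dimensioned
coisotrope. Then the dimensioned Lie idealizer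
`N(I) g = {n ∈ A g | ∀ h, ∀ i ∈ I h, {n, i} ∈ I (b * g * h)}` contains `I`, is closed under
both operations, and the family of quotient groups `g ↦ N(I) g ⧸ I g` carries a well-defined
multiplication of dimension `p` and bracket of dimension `b`, uniquely determined by
`(n + I g) * (m + I h) = n * m + I (p * g * h)` and `{n + I g, m + I h} = {n, m} + I (b * g * h)`,
making it a dimensioned Poisson algebra of dimensions `(p, b)`. -/
theorem dimensioned_poisson_reduction {G : Type u} [CommMonoid G] (p b : G)
    (A : G → Type v) [∀ g, AddCommGroup (A g)] (P : DimPoissonOn p b A)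
    (I : ∀ g, AddSubgroup (A g))
    (hImul : ∀ {g h : G} (x : A g) (i : A h), i ∈ I h → P.mul x i ∈ I (p * g * h))
    (hIbr : ∀ {g h : G} (i : A g) (j : A h),
      i ∈ I g → j ∈ I h → P.bracket i j ∈ I (b * g * h)) :
    ∃ N : ∀ g : G, AddSubgroup (A g),
      -- `N` is the dimensioned Lie idealizer of `I`:
      (∀ g : G, (N g : Set (A g))
        = {n : A g | ∀ (h : G), ∀ i ∈ I h, P.bracket n i ∈ I (b * g * h)}) ∧
      -- `I ⊆ N(I)`:
      (∀ g : G, I g ≤ N g) ∧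
      -- `N(I)` is closed under the multiplication and the bracket:
      ∃ hNmul : ∀ {g h : G} (n : A g) (m : A h),
          n ∈ N g → m ∈ N h → P.mul n m ∈ N (p * g * h),
      ∃ hNbr : ∀ {g h : G} (n : A g) (m : A h),
          n ∈ N g → m ∈ N h → P.bracket n m ∈ N (b * g * h),
      -- the subquotient `N(I)/I` is a dimensioned Poisson algebra of dimensions `(p, b)`:
      ∃ Q : DimPoissonOn p b (fun g => ↥(N g) ⧸ (I g).addSubgroupOf (N g)),
        -- whose operations are determined by those of `A`:
        (∀ {g h : G} (n : A g) (m : A h) (hn : n ∈ N g) (hm : m ∈ N h),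
          Q.mul (QuotientAddGroup.mk (⟨n, hn⟩ : ↥(N g)))
              (QuotientAddGroup.mk (⟨m, hm⟩ : ↥(N h)))
            = QuotientAddGroup.mk (⟨P.mul n m, hNmul n m hn hm⟩ : ↥(N (p * g * h)))) ∧
        (∀ {g h : G} (n : A g) (m : A h) (hn : n ∈ N g) (hm : m ∈ N h),
          Q.bracket (QuotientAddGroup.mk (⟨n, hn⟩ : ↥(N g)))
              (QuotientAddGroup.mk (⟨m, hm⟩ : ↥(N h)))
            = QuotientAddGroup.mk (⟨P.bracket n m, hNbr n m hn hm⟩ : ↥(N (b * g * h)))) ∧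
        -- and uniquely so determined:
        (∀ Q' : DimPoissonOn p b (fun g => ↥(N g) ⧸ (I g).addSubgroupOf (N g)),
          (∀ {g h : G} (n : A g) (m : A h) (hn : n ∈ N g) (hm : m ∈ N h),
            Q'.mul (QuotientAddGroup.mk (⟨n, hn⟩ : ↥(N g)))
                (QuotientAddGroup.mk (⟨m, hm⟩ : ↥(N h)))
              = QuotientAddGroup.mk (⟨P.mul n m, hNmul n m hn hm⟩ : ↥(N (p * g * h)))) →
          (∀ {g h : G} (n : A g) (m : A h) (hn : n ∈ N g) (hm : m ∈ N h),
            Q'.bracket (QuotientAddGroup.mk (⟨n, hn⟩ : ↥(N g)))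
                (QuotientAddGroup.mk (⟨m, hm⟩ : ↥(N h)))
              = QuotientAddGroup.mk (⟨P.bracket n m, hNbr n m hn hm⟩ : ↥(N (b * g * h)))) →
          (∀ (g h : G) (x : ↥(N g) ⧸ (I g).addSubgroupOf (N g))
              (y : ↥(N h) ⧸ (I h).addSubgroupOf (N h)),
            Q'.mul x y = Q.mul x y ∧ Q'.bracket x y = Q.bracket x y)) := by
  refine ⟨P.idealizer I, fun _ => rfl, fun _ _ hi _ _ hj => hIbr _ _ hi hj,
    fun _ _ => P.mul_mem_idealizer hImul, fun _ _ => P.bracket_mem_idealizer,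
    P.reduction hImul, fun _ _ _ _ => rfl, fun _ _ _ _ => rfl, ?_⟩
  rintro Q' hmul hbr g h ⟨x, hx⟩ ⟨y, hy⟩
  exact ⟨hmul x y hx hy, hbr x y hx hy⟩
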